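/- Let n ≥ 1 and let e_1, …, e_{n+1} be the standard basis of ℝ^{n+1}. Let Δ be the convex hull of the finite set {0, e_{n+1}, −e_{n+1}} ∪ {e_i + e_{n+1} : 1 ≤ i ≤ n} ∪ {−e_i + e_{n+1} : 1 ≤ i ≤ n}. Then the Lebesgue measure (volume) of Δ equals 2^{n+1} / (n+1)!. -/

import Mathlib

/-- The convex hull of `0`, `±e_last` and the points `±e_i + e_last` is a pyramid over a
cross-polytope. -/
theorem convexHull_eq_pyramid (n : ℕ) :
    convexHull ℝ
      (({0, Pi.single (Fin.last n) 1, -Pi.single (Fin.last n) 1} ∪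
          Set.range (fun i : Fin n =>
            Pi.single i.castSucc (1 : ℝ) + Pi.single (Fin.last n) 1) ∪
          Set.range (fun i : Fin n =>
            -Pi.single i.castSucc (1 : ℝ) + Pi.single (Fin.last n) 1)) :
        Set (Fin (n + 1) → ℝ)) =
      {x | ∑ i : Fin n, |x i.castSucc| ≤ (1 + x (Fin.last n)) / 2 ∧ x (Fin.last n) ≤ 1} := by
  apply Set.Subset.antisymm
  · apply convexHull_min
    · rintro x (((rfl | rfl | rfl) | ⟨i, rfl⟩) | ⟨i, rfl⟩)
      · simp
      · simp [Fin.castSucc_ne_last]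
      · simp [Fin.castSucc_ne_last]
      · simp [Pi.single_apply, Fin.castSucc_ne_last, (Fin.castSucc_ne_last _).symm, apply_ite abs]
      · simp [Pi.single_apply, Fin.castSucc_ne_last, (Fin.castSucc_ne_last _).symm, apply_ite abs]
    · rintro x ⟨hx, hx'⟩ y ⟨hy, hy'⟩ a b ha hb hab
      refine ⟨?_, ?_⟩
      · have h : ∑ i : Fin n, |(a • x + b • y) i.castSucc| ≤
            a * ∑ i : Fin n, |x i.castSucc| + b * ∑ i : Fin n, |y i.castSucc| := by
          rw [Finset.mul_sum, Finset.mul_sum, ← Finset.sum_add_distrib]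
          refine Finset.sum_le_sum fun i _ => (abs_add_le _ _).trans_eq ?_
          simp [abs_mul, abs_of_nonneg ha, abs_of_nonneg hb]
        simp only [Pi.add_apply, Pi.smul_apply, smul_eq_mul] at h ⊢
        nlinarith [mul_le_mul_of_nonneg_left hx ha, mul_le_mul_of_nonneg_left hy hb]
      · simp only [Pi.add_apply, Pi.smul_apply, smul_eq_mul]
        nlinarith
  · rintro x ⟨hx, hx'⟩
    set K := (({0, Pi.single (Fin.last n) 1, -Pi.single (Fin.last n) 1} ∪
          Set.range (fun i : Fin n =>
            Pi.single i.castSucc (1 : ℝ) + Pi.single (Fin.last n) 1) ∪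
          Set.range (fun i : Fin n =>
            -Pi.single i.castSucc (1 : ℝ) + Pi.single (Fin.last n) 1)) :
        Set (Fin (n + 1) → ℝ)) with hK
    let e : Fin n → Fin (n + 1) → ℝ := fun i =>
      if 0 ≤ x i.castSucc then Pi.single i.castSucc (1 : ℝ) + Pi.single (Fin.last n) 1
      else -Pi.single i.castSucc (1 : ℝ) + Pi.single (Fin.last n) 1
    let z : Option (Option (Fin n)) → Fin (n + 1) → ℝ := fun o =>
      o.elim (Pi.single (Fin.last n) 1) fun o => o.elim (-Pi.single (Fin.last n) 1) e
    let w : Option (Option (Fin n)) → ℝ := fun o =>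
      o.elim ((1 + x (Fin.last n)) / 2 - ∑ i : Fin n, |x i.castSucc|) fun o =>
        o.elim ((1 - x (Fin.last n)) / 2) fun i => |x i.castSucc|
    have key : ∑ o, w o • z o ∈ convexHull ℝ K := by
      refine (convex_convexHull ℝ K).sum_mem ?_ ?_ ?_
      · rintro (_ | _ | i) -
        · exact sub_nonneg.2 hx
        · show 0 ≤ (1 - x (Fin.last n)) / 2
          linarith
        · exact abs_nonneg _
      · simp only [Fintype.sum_option, w, Option.elim]
        ring
      · rintro (_ | _ | i) - <;> apply subset_convexHull ℝ K
        · simp [z, hK]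
        · simp [z, hK]
        · simp only [z, Option.elim, e, hK]
          split_ifs
          · exact Or.inl (Or.inr ⟨i, rfl⟩)
          · exact Or.inr ⟨i, rfl⟩
    convert key using 1
    have he (i : Fin n) : |x i.castSucc| • e i =
        x i.castSucc • Pi.single i.castSucc (1 : ℝ) +
          |x i.castSucc| • Pi.single (Fin.last n) (1 : ℝ) := by
      simp only [e]
      split_ifs with h
      · rw [abs_of_nonneg h, smul_add]
      · rw [abs_of_neg (not_le.1 h), smul_add, smul_neg, neg_smul, neg_neg]
    simp only [Fintype.sum_option, w, z, Option.elim, he]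
    ext j
    refine Fin.lastCases ?_ (fun j => ?_) j
    · simp [Finset.sum_add_distrib, (Fin.castSucc_ne_last _).symm]
      ring
    · simp [Finset.sum_add_distrib, Pi.single_apply, Fin.castSucc_ne_last]

open MeasureTheory in
theorem volume_sum_abs_le (n : ℕ) (hn : 1 ≤ n) (r : ℝ) :
    volume {x : Fin n → ℝ | ∑ i, |x i| ≤ r} =
      ENNReal.ofReal r ^ n * ENNReal.ofReal (2 ^ n / n.factorial) := by
  have : Nonempty (Fin n) := ⟨⟨0, hn⟩⟩
  have h := volume_sum_rpow_le (Fin n) le_rfl r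
  simpa [Real.Gamma_nat_eq_factorial, one_add_one_eq_two, Real.Gamma_two] using h

open MeasureTheory in
theorem volume_pyramid (n : ℕ) (hn : 1 ≤ n) :
    volume {x : Fin (n + 1) → ℝ |
      ∑ i : Fin n, |x i.castSucc| ≤ (1 + x (Fin.last n)) / 2 ∧ x (Fin.last n) ≤ 1} =
      ENNReal.ofReal (2 ^ (n + 1) / (Nat.factorial (n + 1))) := by
  let S : Set (ℝ × (Fin n → ℝ)) := {p | ∑ i, |p.2 i| ≤ (1 + p.1) / 2 ∧ p.1 ≤ 1}
  have hS : MeasurableSet S := by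
    have h₁ : IsClosed {p : ℝ × (Fin n → ℝ) | ∑ i, |p.2 i| ≤ (1 + p.1) / 2} :=
      isClosed_le (by fun_prop) (by fun_prop)
    have h₂ : IsClosed {p : ℝ × (Fin n → ℝ) | p.1 ≤ 1} := isClosed_le (by fun_prop) (by fun_prop)
    exact (h₁.inter h₂).measurableSet
  have hp := (volume_preserving_piFinSuccAbove (fun _ : Fin (n + 1) => ℝ) (Fin.last n)).measure_preimage
    hS.nullMeasurableSet
  have hpre : {x : Fin (n + 1) → ℝ |
      ∑ i : Fin n, |x i.castSucc| ≤ (1 + x (Fin.last n)) / 2 ∧ x (Fin.last n) ≤ 1} =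
      (MeasurableEquiv.piFinSuccAbove (fun _ : Fin (n + 1) => ℝ) (Fin.last n)) ⁻¹' S := by
    ext x
    simp [S, MeasurableEquiv.piFinSuccAbove, Fin.init]
  have hslice (t : ℝ) : volume (Prod.mk t ⁻¹' S) =
      (Set.Ioc (-1 : ℝ) 1).indicator
        (fun t => ENNReal.ofReal (((1 + t) / 2) ^ n * (2 ^ n / n.factorial))) t := by
    by_cases h1 : t ≤ 1
    · have hs : Prod.mk t ⁻¹' S = {x : Fin n → ℝ | ∑ i, |x i| ≤ (1 + t) / 2} := by
        ext x
        simp [S, h1]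
      rw [hs, volume_sum_abs_le n hn]
      by_cases h2 : -1 < t
      · rw [Set.indicator_of_mem (Set.mem_Ioc.2 ⟨h2, h1⟩), ENNReal.ofReal_mul (pow_nonneg (by linarith) _),
          ENNReal.ofReal_pow (by linarith)]
      · rw [Set.indicator_of_notMem fun h => h2 h.1, ENNReal.ofReal_of_nonpos (by linarith),
          zero_pow (by omega), zero_mul]
    · rw [Set.indicator_of_notMem fun h => h1 h.2]
      have hs : Prod.mk t ⁻¹' S = ∅ := by
        ext x
        simp [S, h1]
      rw [hs, measure_empty]
  rw [hpre, hp, Measure.volume_eq_prod, Measure.prod_apply hS]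
  simp_rw [hslice]
  rw [lintegral_indicator measurableSet_Ioc, ← ofReal_integral_eq_lintegral_ofReal,
    ← intervalIntegral.integral_of_le (by norm_num)]
  · congr 1
    have hcomp := intervalIntegral.integral_comp_add_div
      (fun u : ℝ => u ^ n) (a := -1) (b := 1) (two_ne_zero' ℝ) (1 / 2)
    have hsplit (t : ℝ) : (1 + t) / 2 = 1 / 2 + t / 2 := by ring
    simp_rw [hsplit]
    rw [intervalIntegral.integral_mul_const, hcomp, integral_pow, Nat.factorial_succ]
    push_cast
    have : (n.factorial : ℝ) ≠ 0 := by positivity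
    norm_num
    field_simp
    ring
  · exact Continuous.integrableOn_Ioc (by fun_prop)
  · refine (ae_restrict_iff' measurableSet_Ioc).2 (.of_forall fun t ht => ?_)
    have : 0 ≤ (1 + t) / 2 := by linarith [ht.1]
    show 0 ≤ ((1 + t) / 2) ^ n * (2 ^ n / (n.factorial : ℝ))
    positivity

theorem stmt9 (n : ℕ) (hn : 1 ≤ n) :
    MeasureTheory.volume
        (convexHull ℝ
          (({0, Pi.single (Fin.last n) 1, -Pi.single (Fin.last n) 1} ∪
              Set.range (fun i : Fin n =>
                Pi.single i.castSucc (1 : ℝ) + Pi.single (Fin.last n) 1) ∪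
              Set.range (fun i : Fin n =>
                -Pi.single i.castSucc (1 : ℝ) + Pi.single (Fin.last n) 1)) :
            Set (Fin (n + 1) → ℝ))) =
      ENNReal.ofReal (2 ^ (n + 1) / (Nat.factorial (n + 1))) := by
  rw [convexHull_eq_pyramid, volume_pyramid n hn]
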